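/- arXiv:1904.01253 — 5 statements merged into one kernel-verified Lean document; each statement's English description precedes it below -/
import Mathlib

section
/- Let U ⊆ ℂ be an open set, r ≥ 1 an integer, and let P, P⁎, I, Ω, Ω⁎ : U → Mat_r(ℂ) be matrix-valued functions such that P, P⁎ and I are differentiable at every point of U (entrywise), P(z), P⁎(z), and I(z) are invertible for every z ∈ U, the derivative identities P′(z) = Ω(z)ᵀ · P(z) and (P⁎)′(z) = Ω⁎(z)ᵀ · P⁎(z) hold on U, and the function z ↦ P(z)ᵀ · (I(z)ᵀ)⁻¹ · P⁎(z) has zero derivative at every point of U. Then I satisfies the secondary equation: for every z ∈ U, I′(z) = Ω(z)ᵀ · I(z) + I(z) · Ω⁎(z). -/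
open Matrix

theorem Matrix.hasDerivAt_iff_entrywise {n : Type*} [Fintype n]
    {A : ℂ → Matrix n n ℂ} {A' : Matrix n n ℂ} {z : ℂ} :
    HasDerivAt A A' z ↔ ∀ i j, HasDerivAt (fun w => A w i j) (A' i j) z := by
  have h := hasDerivAt_pi (φ := (A : ℂ → n → n → ℂ)) (φ' := (A' : n → n → ℂ)) (x := z)
  simp only [hasDerivAt_pi] at h
  exact h

section MatrixDeriv

attribute [local instance] Matrix.linftyOpNormedRing Matrix.linftyOpNormedAlgebra

theorem Matrix.hasDerivAt_inv_apply {n : Type*} [Fintype n] [DecidableEq n]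
    {A : ℂ → Matrix n n ℂ} {A' : Matrix n n ℂ} {z : ℂ}
    (hA : ∀ i j, HasDerivAt (fun w => A w i j) (A' i j) z) (hu : IsUnit (A z)) (i j : n) :
    HasDerivAt (fun w => (A w)⁻¹ i j) ((-((A z)⁻¹ * A' * (A z)⁻¹)) i j) z := by
  revert i j
  rw [← Matrix.hasDerivAt_iff_entrywise (A := fun w => (A w)⁻¹)]
  obtain ⟨u, hu⟩ := hu
  have h := hasFDerivAt_ringInverse (𝕜 := ℂ) u
  rw [hu] at h
  have h2 := h.comp_hasDerivAt z (Matrix.hasDerivAt_iff_entrywise.2 hA)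
  have e : (↑u⁻¹ : Matrix n n ℂ) = (A z)⁻¹ := by rw [← hu, Matrix.coe_units_inv]
  simp only [Function.comp_def, ← Matrix.nonsing_inv_eq_ringInverse, e,
    _root_.neg_apply, ContinuousLinearMap.mulLeftRight_apply] at h2
  exact h2

end MatrixDeriv

theorem Matrix.hasDerivAt_mul_apply {l m n : Type*} [Fintype m]
    {A : ℂ → Matrix l m ℂ} {B : ℂ → Matrix m n ℂ} {A' : Matrix l m ℂ} {B' : Matrix m n ℂ} {z : ℂ}
    (hA : ∀ i j, HasDerivAt (fun w => A w i j) (A' i j) z)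
    (hB : ∀ i j, HasDerivAt (fun w => B w i j) (B' i j) z) (i : l) (j : n) :
    HasDerivAt (fun w => (A w * B w) i j) ((A' * B z + A z * B') i j) z := by
  simp only [Matrix.add_apply, Matrix.mul_apply, ← Finset.sum_add_distrib]
  exact HasDerivAt.fun_sum fun k _ => (hA i k).mul (hB k j)

/-- Derivation of the secondary equation (2.9) from the twisted period relation:
if dP = ᵗΩ P, dP⁎ = ᵗΩ⁎ P⁎, P, P⁎, I are invertible and ᵗP (ᵗI)⁻¹ P⁎ is locally
constant, then dI = ᵗΩ I + I Ω⁎. -/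
theorem secondary_equation
    (U : Set ℂ) (hU : IsOpen U) (r : ℕ) (hr : 1 ≤ r)
    (P Pd I I' Ω Ωd : ℂ → Matrix (Fin r) (Fin r) ℂ)
    (hP : ∀ z ∈ U, ∀ i j, HasDerivAt (fun w => P w i j) (((Ω z)ᵀ * P z) i j) z)
    (hPd : ∀ z ∈ U, ∀ i j, HasDerivAt (fun w => Pd w i j) (((Ωd z)ᵀ * Pd z) i j) z)
    (hI : ∀ z ∈ U, ∀ i j, HasDerivAt (fun w => I w i j) (I' z i j) z)
    (hPinv : ∀ z ∈ U, IsUnit (P z))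
    (hPdinv : ∀ z ∈ U, IsUnit (Pd z))
    (hIinv : ∀ z ∈ U, IsUnit (I z))
    (hconst : ∀ z ∈ U, ∀ i j,
      HasDerivAt (fun w => ((P w)ᵀ * ((I w)ᵀ)⁻¹ * Pd w) i j) 0 z) :
    ∀ z ∈ U, I' z = (Ω z)ᵀ * I z + I z * Ωd z := by
  intro z hz
  have hIt : IsUnit (I z)ᵀ.det := by
    rw [Matrix.det_transpose]; exact (Matrix.isUnit_iff_isUnit_det _).1 (hIinv z hz)
  have hK := Matrix.hasDerivAt_mul_apply
    (Matrix.hasDerivAt_mul_apply (A := fun w => (P w)ᵀ) (A' := ((Ω z)ᵀ * P z)ᵀ)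
      (fun i j => hP z hz j i)
      (Matrix.hasDerivAt_inv_apply (A := fun w => (I w)ᵀ) (A' := (I' z)ᵀ)
        (fun i j => hI z hz j i) ((Matrix.isUnit_iff_isUnit_det _).2 hIt)))
    (hPd z hz)
  have h0 : (P z)ᵀ * (Ω z * ((I z)ᵀ)⁻¹ - ((I z)ᵀ)⁻¹ * (I' z)ᵀ * ((I z)ᵀ)⁻¹
      + ((I z)ᵀ)⁻¹ * (Ωd z)ᵀ) * Pd z = 0 := by
    ext i j
    rw [Matrix.zero_apply, ← (hK i j).unique (hconst z hz i j)]
    simp only [Matrix.transpose_mul, Matrix.transpose_transpose]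
    noncomm_ring
  have h1 := (hPdinv z hz).mul_left_eq_zero.1 h0
  have hPt : IsUnit (P z)ᵀ := by
    rw [Matrix.isUnit_iff_isUnit_det, Matrix.det_transpose]
    exact (Matrix.isUnit_iff_isUnit_det _).1 (hPinv z hz)
  have h2 := hPt.mul_right_eq_zero.1 h1
  have hmul := Matrix.mul_nonsing_inv _ hIt
  have hinv := Matrix.nonsing_inv_mul _ hIt
  have h3 : (I z)ᵀ * Ω z - (I' z)ᵀ + (Ωd z)ᵀ * (I z)ᵀ = 0 := by
    calc _ = (I z)ᵀ * Ω z * (((I z)ᵀ)⁻¹ * (I z)ᵀ)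
          - ((I z)ᵀ * ((I z)ᵀ)⁻¹) * (I' z)ᵀ * (((I z)ᵀ)⁻¹ * (I z)ᵀ)
          + ((I z)ᵀ * ((I z)ᵀ)⁻¹) * (Ωd z)ᵀ * (I z)ᵀ := by
          rw [hmul, hinv]; simp only [Matrix.mul_one, Matrix.one_mul]
      _ = (I z)ᵀ * (Ω z * ((I z)ᵀ)⁻¹ - ((I z)ᵀ)⁻¹ * (I' z)ᵀ * ((I z)ᵀ)⁻¹
            + ((I z)ᵀ)⁻¹ * (Ωd z)ᵀ) * (I z)ᵀ := by noncomm_ring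
      _ = 0 := by rw [h2, Matrix.mul_zero, Matrix.zero_mul]
  have h4 := congrArg Matrix.transpose h3
  simp only [Matrix.transpose_add, Matrix.transpose_sub, Matrix.transpose_mul,
    Matrix.transpose_transpose, Matrix.transpose_zero] at h4
  rw [eq_comm, ← sub_eq_zero, ← h4]
  abel
end

section
/- Let c, γ₁, γ₂ ∈ ℂ with γ₁ + γ₂ ≠ 0, and let z ∈ ℂ with z ≠ 0 and z ≠ 1. Define the 2×2 complex matrices Ω = [[0, −cγ₂/(z−1)], [1/z, (−(c+γ₂)z + c − γ₁)/(z(z−1))]], Ω⁎ = [[0, −cγ₂/(z−1)], [1/z, ((c+γ₂)z − c + γ₁)/(z(z−1))]], and the constant matrix I = [[1, cγ₂/(γ₁+γ₂)], [−cγ₂/(γ₁+γ₂), cγ₂(γ₁−c)/(γ₁+γ₂)]]. Then Ωᵀ · I + I · Ω⁎ = 0; in other words, the constant matrix I is a rational solution of the secondary equation dI/dz = Ωᵀ I + I Ω⁎ associated to the Gauss hypergeometric connection. -/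
open Matrix

/-- Example 3.1: the constant matrix `I` is a rational solution of the secondary
equation `dI/dz = ᵗΩ I + I Ω⁎` for the Gauss hypergeometric connection, i.e.
`ᵗΩ I + I Ω⁎ = 0`. -/
theorem gauss_secondary_equation_solution
    (c γ₁ γ₂ z : ℂ) (hγ : γ₁ + γ₂ ≠ 0) (hz0 : z ≠ 0) (hz1 : z ≠ 1) :
    let Ω : Matrix (Fin 2) (Fin 2) ℂ :=
      !![0, -c * γ₂ / (z - 1);
         1 / z, (-(c + γ₂) * z + c - γ₁) / (z * (z - 1))]
    let Ωd : Matrix (Fin 2) (Fin 2) ℂ :=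
      !![0, -c * γ₂ / (z - 1);
         1 / z, ((c + γ₂) * z - c + γ₁) / (z * (z - 1))]
    let I : Matrix (Fin 2) (Fin 2) ℂ :=
      !![1, c * γ₂ / (γ₁ + γ₂);
         -c * γ₂ / (γ₁ + γ₂), c * γ₂ * (γ₁ - c) / (γ₁ + γ₂)]
    Ωᵀ * I + I * Ωd = 0 := by
  intro Ω Ωd I
  have hz : z - 1 ≠ 0 := sub_ne_zero.mpr hz1
  ext i j
  fin_cases i <;> fin_cases j <;>
    simp [Ω, Ωd, I, Matrix.mul_apply, Fin.sum_univ_two] <;>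
    field_simp <;>
    ring
end

section
/- Let γ₁, γ₂, c ∈ ℂ be such that none of γ₁, γ₂, c, c−γ₁, c−γ₁−γ₂ is an integer. Then γ₁γ₂ · [ π³/(sin(π(γ₁−c)) sin(πc) sin(πγ₂)) · 1/(Γ(1+c−γ₁)Γ(1−c)Γ(1−γ₂)Γ(1−c+γ₁)Γ(1+c)Γ(1+γ₂)) + π³/(sin(πγ₁) sin(π(γ₁+γ₂−c)) sin(π(c−γ₁))) · 1/(Γ(1−γ₁)Γ(1+c−γ₁−γ₂)Γ(1+γ₁−c)Γ(1+γ₁)Γ(1−c+γ₁+γ₂)Γ(1−γ₁+c)) ] = −(γ₁+γ₂)/(c(c−γ₁−γ₂)). -/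
theorem Complex.Gamma_one_add_mul_Gamma_one_sub {w : ℂ} (hw : w ≠ 0) :
    Complex.Gamma (1 + w) * Complex.Gamma (1 - w) =
      w * ((Real.pi : ℂ) / Complex.sin ((Real.pi : ℂ) * w)) := by
  rw [add_comm, Complex.Gamma_add_one w hw, mul_assoc, Complex.Gamma_mul_Gamma_one_sub]

theorem Complex.sin_pi_mul_ne_zero {w : ℂ} (hw : ∀ n : ℤ, w ≠ n) :
    Complex.sin ((Real.pi : ℂ) * w) ≠ 0 := by
  rw [Complex.sin_ne_zero_iff]
  intro k h
  rw [mul_comm (k : ℂ)] at h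
  exact hw k (mul_left_cancel₀ (Complex.ofReal_ne_zero.mpr Real.pi_ne_zero) h)

theorem Complex.pi_div_sin_mul_inv_Gamma {w : ℂ} (hw : ∀ n : ℤ, w ≠ n) :
    (Real.pi : ℂ) / Complex.sin ((Real.pi : ℂ) * w) *
      (Complex.Gamma (1 + w) * Complex.Gamma (1 - w))⁻¹ = w⁻¹ := by
  have hw₀ : w ≠ 0 := by simpa using hw 0
  have hs := Complex.sin_pi_mul_ne_zero hw
  have hπ : (Real.pi : ℂ) ≠ 0 := Complex.ofReal_ne_zero.mpr Real.pi_ne_zero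
  rw [Complex.Gamma_one_add_mul_Gamma_one_sub hw₀]
  field_simp

theorem Complex.pi_cube_div_sin_mul_inv_Gamma {u v w : ℂ} (hu : ∀ n : ℤ, u ≠ n)
    (hv : ∀ n : ℤ, v ≠ n) (hw : ∀ n : ℤ, w ≠ n) :
    (Real.pi : ℂ) ^ 3 /
        (Complex.sin ((Real.pi : ℂ) * u) * Complex.sin ((Real.pi : ℂ) * v) *
          Complex.sin ((Real.pi : ℂ) * w)) *
        (1 / (Complex.Gamma (1 - u) * Complex.Gamma (1 - v) * Complex.Gamma (1 - w) *
          Complex.Gamma (1 + u) * Complex.Gamma (1 + v) * Complex.Gamma (1 + w))) =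
      (u * v * w)⁻¹ := by
  rw [mul_inv, mul_inv, ← Complex.pi_div_sin_mul_inv_Gamma hu,
    ← Complex.pi_div_sin_mul_inv_Gamma hv, ← Complex.pi_div_sin_mul_inv_Gamma hw]
  simp only [div_eq_mul_inv, mul_inv]
  ring


/-- The constant-term computation (3.15) of Example 3.1. -/
theorem gauss_constant_term
    (γ₁ γ₂ c : ℂ)
    (hγ₁ : ∀ n : ℤ, γ₁ ≠ n) (hγ₂ : ∀ n : ℤ, γ₂ ≠ n) (hc : ∀ n : ℤ, c ≠ n)
    (hcγ₁ : ∀ n : ℤ, c - γ₁ ≠ n) (hcγ₁γ₂ : ∀ n : ℤ, c - γ₁ - γ₂ ≠ n) :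
    γ₁ * γ₂ *
      ((Real.pi : ℂ) ^ 3 /
          (Complex.sin ((Real.pi : ℂ) * (γ₁ - c)) * Complex.sin ((Real.pi : ℂ) * c) *
            Complex.sin ((Real.pi : ℂ) * γ₂)) *
          (1 / (Complex.Gamma (1 + c - γ₁) * Complex.Gamma (1 - c) *
            Complex.Gamma (1 - γ₂) * Complex.Gamma (1 - c + γ₁) *
            Complex.Gamma (1 + c) * Complex.Gamma (1 + γ₂))) +
        (Real.pi : ℂ) ^ 3 /
          (Complex.sin ((Real.pi : ℂ) * γ₁) *
            Complex.sin ((Real.pi : ℂ) * (γ₁ + γ₂ - c)) *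
            Complex.sin ((Real.pi : ℂ) * (c - γ₁))) *
          (1 / (Complex.Gamma (1 - γ₁) * Complex.Gamma (1 + c - γ₁ - γ₂) *
            Complex.Gamma (1 + γ₁ - c) * Complex.Gamma (1 + γ₁) *
            Complex.Gamma (1 - c + γ₁ + γ₂) * Complex.Gamma (1 - γ₁ + c)))) =
      -(γ₁ + γ₂) / (c * (c - γ₁ - γ₂)) := by
  have neg_ne {w : ℂ} (hw : ∀ n : ℤ, w ≠ n) (n : ℤ) : -w ≠ n := fun h =>
    hw (-n) (by rw [Int.cast_neg, ← h, neg_neg])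
  have hd : ∀ n : ℤ, γ₁ - c ≠ n := by simpa using neg_ne hcγ₁
  have he : ∀ n : ℤ, γ₁ + γ₂ - c ≠ n := fun n h =>
    neg_ne hcγ₁γ₂ n (by rw [← h]; ring)
  have h₁ := Complex.pi_cube_div_sin_mul_inv_Gamma hd hc hγ₂
  have h₂ := Complex.pi_cube_div_sin_mul_inv_Gamma hγ₁ he hcγ₁
  rw [show 1 - (γ₁ - c) = 1 + c - γ₁ by ring, show 1 + (γ₁ - c) = 1 - c + γ₁ by ring] at h₁
  rw [show 1 - (γ₁ + γ₂ - c) = 1 + c - γ₁ - γ₂ by ring,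
    show 1 - (c - γ₁) = 1 + γ₁ - c by ring,
    show 1 + (γ₁ + γ₂ - c) = 1 - c + γ₁ + γ₂ by ring,
    show 1 + (c - γ₁) = 1 - γ₁ + c by ring] at h₂
  rw [h₁, h₂, show γ₁ - c = -(c - γ₁) by ring,
    show γ₁ + γ₂ - c = -(c - γ₁ - γ₂) by ring]
  have hγ₁0 : γ₁ ≠ 0 := by simpa using hγ₁ 0
  have hγ₂0 : γ₂ ≠ 0 := by simpa using hγ₂ 0
  have hc0 : c ≠ 0 := by simpa using hc 0
  have hd0 : c - γ₁ ≠ 0 := by simpa only [Int.cast_zero] using hcγ₁ 0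
  have he0 : c - γ₁ - γ₂ ≠ 0 := by simpa only [Int.cast_zero] using hcγ₁γ₂ 0
  field_simp
  ring
end

section
/- For ε ∈ ℂ nonzero with sin(πε) ≠ 0 and cos(2πε) ≠ 0, define α(ε) = π³/(sin²(πε)cos(2πε)), β(ε) = −π³/sin²(πε), the diagonal 4×4 matrix D(ε) = diag(α(ε), β(ε), β(ε), α(ε)), and the 4×4 matrix Q(ε) = [[1, −ε⁻¹, −ε⁻¹, ε⁻²], [0, ε⁻¹, 0, −ε⁻²], [0, 0, ε⁻¹, −ε⁻²], [0, 0, 0, ε⁻²]] (which is invertible). Then, as ε → 0 through nonzero values, the matrix Q(ε)⁻¹ · D(ε) · (Q(ε)⁻¹)ᵀ converges to the matrix [[4π³, 0, 0, π], [0, 0, π, 0], [0, π, 0, 0], [π, 0, 0, 0]]. -/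
open Matrix

open Filter Topology

/-- The inverse of the Frobenius change-of-basis matrix. -/
theorem frobeniusMatrix_inv {ε : ℂ} (hε : ε ≠ 0) :
    (!![1, -ε⁻¹, -ε⁻¹, ε⁻¹ ^ 2;
        0, ε⁻¹, 0, -ε⁻¹ ^ 2;
        0, 0, ε⁻¹, -ε⁻¹ ^ 2;
        0, 0, 0, ε⁻¹ ^ 2] : Matrix (Fin 4) (Fin 4) ℂ)⁻¹ =
      !![1, 1, 1, 1; 0, ε, 0, ε; 0, 0, ε, ε; 0, 0, 0, ε ^ 2] := by
  apply Matrix.inv_eq_right_inv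
  ext i j
  fin_cases i <;> fin_cases j <;> simp [Matrix.mul_apply, Fin.sum_univ_four, hε]

/-- Congruence of `diag(α, β, β, α)` by the inverse Frobenius matrix. -/
theorem frobeniusMatrix_congr_diag (ε α β : ℂ) :
    (!![1, 1, 1, 1; 0, ε, 0, ε; 0, 0, ε, ε; 0, 0, 0, ε ^ 2] : Matrix (Fin 4) (Fin 4) ℂ) *
        !![α, 0, 0, 0; 0, β, 0, 0; 0, 0, β, 0; 0, 0, 0, α] *
        (!![1, 1, 1, 1; 0, ε, 0, ε; 0, 0, ε, ε; 0, 0, 0, ε ^ 2])ᵀ =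
      !![2 * (α + β), ε * (α + β), ε * (α + β), ε ^ 2 * α;
         ε * (α + β), ε ^ 2 * (α + β), ε ^ 2 * α, ε * (ε ^ 2 * α);
         ε * (α + β), ε ^ 2 * α, ε ^ 2 * (α + β), ε * (ε ^ 2 * α);
         ε ^ 2 * α, ε * (ε ^ 2 * α), ε * (ε ^ 2 * α), ε ^ 2 * (ε ^ 2 * α)] := by
  ext i j
  fin_cases i <;> fin_cases j <;> simp [Matrix.mul_apply, Fin.sum_univ_four] <;> ring

theorem tendsto_sin_const_mul_div (c : ℂ) :
    Tendsto (fun ε : ℂ => Complex.sin (c * ε) / ε) (𝓝[≠] 0) (𝓝 c) := by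
  have h : HasDerivAt (fun ε : ℂ => Complex.sin (c * ε)) c 0 := by
    simpa using ((hasDerivAt_id (0 : ℂ)).const_mul c).csin
  simpa [hasDerivAt_iff_tendsto_slope, slope_fun_def, div_eq_inv_mul] using h

theorem tendsto_cos_const_mul (c : ℂ) :
    Tendsto (fun ε : ℂ => Complex.cos (c * ε)) (𝓝[≠] 0) (𝓝 1) := by
  have h : Continuous fun ε : ℂ => Complex.cos (c * ε) := by fun_prop
  simpa using (h.tendsto 0).mono_left nhdsWithin_le_nhds

/-- The limit of `ε² α(ε)`. -/
theorem tendsto_sq_mul_div_sin_sq_mul_cos {c : ℂ} (hc : c ≠ 0) :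
    Tendsto (fun ε : ℂ => ε ^ 2 * (c ^ 3 / (Complex.sin (c * ε) ^ 2 * Complex.cos (2 * c * ε))))
      (𝓝[≠] 0) (𝓝 c) := by
  have h := (tendsto_const_nhds (x := c ^ 3)).div
    (((tendsto_sin_const_mul_div c).pow 2).mul (tendsto_cos_const_mul (2 * c))) (by simpa using hc)
  have hlim : c ^ 3 / (c ^ 2 * 1) = c := by field_simp
  rw [hlim] at h
  refine h.congr' ?_
  filter_upwards [self_mem_nhdsWithin] with ε hε
  have hε : ε ≠ 0 := hε
  simp only [Pi.div_apply]
  rw [div_pow, div_mul_eq_mul_div, div_div_eq_mul_div]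
  ring

/-- The limit of `α(ε) + β(ε)`. -/
theorem tendsto_div_sin_sq_mul_cos_add {c : ℂ} (hc : c ≠ 0) :
    Tendsto (fun ε : ℂ => c ^ 3 / (Complex.sin (c * ε) ^ 2 * Complex.cos (2 * c * ε)) +
      -c ^ 3 / Complex.sin (c * ε) ^ 2) (𝓝[≠] 0) (𝓝 (2 * c ^ 3)) := by
  have h := (tendsto_const_nhds (x := 2 * c ^ 3)).div (tendsto_cos_const_mul (2 * c)) one_ne_zero
  rw [div_one] at h
  refine h.congr' ?_
  filter_upwards [(tendsto_sin_const_mul_div c).eventually_ne hc,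
    (tendsto_cos_const_mul (2 * c)).eventually_ne one_ne_zero] with ε hs hcos
  have hsin : Complex.sin (c * ε) ≠ 0 := fun h0 => hs (by simp [h0])
  have hdouble : Complex.cos (2 * c * ε) = 1 - 2 * Complex.sin (c * ε) ^ 2 := by
    rw [mul_assoc, Complex.cos_two_mul, Complex.cos_sq']
    ring
  simp only [Pi.div_apply]
  field_simp
  rw [hdouble]
  ring

/-- The limit computation underlying (4.21): with α(ε) = π³/(sin²(πε)cos(2πε)),
β(ε) = −π³/sin²(πε), D(ε) = diag(α,β,β,α) and the Frobenius change-of-basis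
matrix Q(ε), the matrix Q(ε)⁻¹ D(ε) ᵗ(Q(ε)⁻¹) converges, as ε → 0 through
nonzero values, to [[4π³,0,0,π],[0,0,π,0],[0,π,0,0],[π,0,0,0]]. -/
theorem K3_frobenius_limit :
    Filter.Tendsto
      (fun ε : ℂ =>
        (let α : ℂ := (Real.pi : ℂ) ^ 3 /
            (Complex.sin ((Real.pi : ℂ) * ε) ^ 2 * Complex.cos (2 * (Real.pi : ℂ) * ε));
         let β : ℂ := -(Real.pi : ℂ) ^ 3 / Complex.sin ((Real.pi : ℂ) * ε) ^ 2;
         let D : Matrix (Fin 4) (Fin 4) ℂ :=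
            !![α, 0, 0, 0; 0, β, 0, 0; 0, 0, β, 0; 0, 0, 0, α];
         let Q : Matrix (Fin 4) (Fin 4) ℂ :=
            !![1, -ε⁻¹, -ε⁻¹, ε⁻¹ ^ 2;
               0, ε⁻¹, 0, -ε⁻¹ ^ 2;
               0, 0, ε⁻¹, -ε⁻¹ ^ 2;
               0, 0, 0, ε⁻¹ ^ 2];
         Q⁻¹ * D * (Q⁻¹)ᵀ))
      (nhdsWithin 0 {(0 : ℂ)}ᶜ)
      (nhds (!![4 * (Real.pi : ℂ) ^ 3, 0, 0, (Real.pi : ℂ);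
                0, 0, (Real.pi : ℂ), 0;
                0, (Real.pi : ℂ), 0, 0;
                (Real.pi : ℂ), 0, 0, 0])) := by
  have hπ : (Real.pi : ℂ) ≠ 0 := Complex.ofReal_ne_zero.mpr Real.pi_ne_zero
  have hα := tendsto_sq_mul_div_sin_sq_mul_cos hπ
  have hαβ := tendsto_div_sin_sq_mul_cos_add hπ
  have hε : Tendsto (fun ε : ℂ => ε) (𝓝[≠] 0) (𝓝 0) := nhdsWithin_le_nhds
  have h00 := hαβ.const_mul 2
  have h01 := hε.mul hαβ
  have h11 := (hε.pow 2).mul hαβ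
  have h13 := hε.mul hα
  have h33 := (hε.pow 2).mul hα
  have h4 : (2 : ℂ) * (2 * (Real.pi : ℂ) ^ 3) = 4 * (Real.pi : ℂ) ^ 3 := by ring
  rw [h4] at h00
  rw [zero_mul] at h01 h13
  rw [zero_pow two_ne_zero, zero_mul] at h11 h33
  refine tendsto_pi_nhds.mpr fun i => tendsto_pi_nhds.mpr fun j => ?_
  have heq : ∀ᶠ ε : ℂ in 𝓝[≠] 0, _ = _ := eventually_nhdsWithin_of_forall fun ε hε =>
    congrFun (congrFun ((frobeniusMatrix_congr_diag ε
      ((Real.pi : ℂ) ^ 3 /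
        (Complex.sin ((Real.pi : ℂ) * ε) ^ 2 * Complex.cos (2 * (Real.pi : ℂ) * ε)))
      (-(Real.pi : ℂ) ^ 3 / Complex.sin ((Real.pi : ℂ) * ε) ^ 2)).symm.trans
        (by rw [← frobeniusMatrix_inv hε])) i) j
  refine Tendsto.congr' heq ?_
  fin_cases i <;> fin_cases j <;> assumption
end

section
/- For every natural number n, the identity Σ_{k=0}^{n} [ (1/8)_k (3/8)_k / (k!)² ] · [ (1/8)_{n−k} (3/8)_{n−k} / ((n−k)!)² ] = (1/4)_n (1/2)_n (3/4)_n / (n!)³ holds in ℚ, where (a)_k = a(a+1)⋯(a+k−1) denotes the rising factorial (Pochhammer symbol), with (a)_0 = 1. -/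
open Finset in
/-- The Cauchy square of a sequence satisfying the recurrence of the coefficients of
`₂F₁(a, b; 1; w)` with `a + b = 1 / 2` satisfies the recurrence of the coefficients of
`₃F₂(2a, 1 / 2, 2b; 1, 1; w)`. -/
theorem clausen_recurrence {K : Type*} [Field K] [CharZero K] {a b : K} (hab : a + b = 1 / 2)
    {u : ℕ → K} (hu : ∀ k : ℕ, ((k : K) + 1) ^ 2 * u (k + 1) = (a + k) * (b + k) * u k) (n : ℕ) :
    ((n : K) + 1) ^ 3 * ∑ p ∈ antidiagonal (n + 1), u p.1 * u p.2 =
      (2 * a + n) * (1 / 2 + n) * (2 * b + n) * ∑ p ∈ antidiagonal n, u p.1 * u p.2 := by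
  have swap (m : ℕ) (f : ℕ → ℕ → K) :
      ∑ p ∈ antidiagonal m, f p.2 p.1 = ∑ p ∈ antidiagonal m, f p.1 p.2 :=
    Finset.Nat.sum_antidiagonal_swap (f := fun p => f p.1 p.2)
  have shift : ∑ p ∈ antidiagonal (n + 1), (p.1 : K) ^ 2 * (p.1 + 3 * p.2) * (u p.1 * u p.2) =
      ∑ p ∈ antidiagonal n, (a + p.1) * (b + p.1) * (p.1 + 1 + 3 * p.2) * (u p.1 * u p.2) := by
    rw [Finset.Nat.sum_antidiagonal_succ]
    simp only [Nat.cast_zero, Nat.cast_add, Nat.cast_one, ne_eq, OfNat.ofNat_ne_zero,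
      not_false_eq_true, zero_pow, zero_mul, zero_add]
    refine sum_congr rfl fun p _ => ?_
    linear_combination ((p.1 : K) + 1 + 3 * p.2) * u p.2 * hu p.1
  have hb : b = 1 / 2 - a := by linear_combination hab
  calc
    _ = ∑ p ∈ antidiagonal (n + 1), (p.1 : K) ^ 2 * (p.1 + 3 * p.2) * (u p.1 * u p.2) +
        ∑ p ∈ antidiagonal (n + 1), (p.2 : K) ^ 2 * (p.2 + 3 * p.1) * (u p.2 * u p.1) := by
      rw [mul_sum, ← sum_add_distrib]
      refine sum_congr rfl fun p hp => ?_
      have h : (p.1 : K) + p.2 = n + 1 := mod_cast mem_antidiagonal.mp hp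
      rw [← h]
      ring
    _ = ∑ p ∈ antidiagonal n, (a + p.1) * (b + p.1) * (p.1 + 1 + 3 * p.2) * (u p.1 * u p.2) +
        ∑ p ∈ antidiagonal n, (a + p.2) * (b + p.2) * (p.2 + 1 + 3 * p.1) * (u p.2 * u p.1) := by
      rw [swap (n + 1) fun i j => (i : K) ^ 2 * (i + 3 * j) * (u i * u j),
        swap n fun i j => (a + i) * (b + i) * (i + 1 + 3 * j) * (u i * u j), shift]
    _ = _ := by
      rw [mul_sum, ← sum_add_distrib]
      refine sum_congr rfl fun p hp => ?_
      have h : (p.1 : K) + p.2 = n := mod_cast mem_antidiagonal.mp hp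
      rw [← h, hb]
      ring

/-- Coefficient-wise form of Clausen's identity
`₃F₂(2a, 1 / 2, 2b; 1, 1; w) = ₂F₁(a, b; 1; w) ^ 2` for `a + b = 1 / 2`. -/
theorem sum_antidiagonal_clausen {K : Type*} [Field K] [CharZero K] {a b : K}
    (hab : a + b = 1 / 2) (n : ℕ) :
    ∑ p ∈ Finset.HasAntidiagonal.antidiagonal n,
        ((ascPochhammer K p.1).eval a * (ascPochhammer K p.1).eval b / (p.1.factorial : K) ^ 2) *
          ((ascPochhammer K p.2).eval a * (ascPochhammer K p.2).eval b /
            (p.2.factorial : K) ^ 2) =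
      (ascPochhammer K n).eval (2 * a) * (ascPochhammer K n).eval (1 / 2) *
        (ascPochhammer K n).eval (2 * b) / (n.factorial : K) ^ 3 := by
  induction n with
  | zero => simp
  | succ n ih =>
    have step := clausen_recurrence hab (u := fun k =>
      (ascPochhammer K k).eval a * (ascPochhammer K k).eval b / (k.factorial : K) ^ 2)
      (fun k => by
        have hk : (k : K) + 1 ≠ 0 := Nat.cast_add_one_ne_zero k
        have hf : (k.factorial : K) ≠ 0 := Nat.cast_ne_zero.mpr k.factorial_ne_zero
        simp only [ascPochhammer_succ_eval, Nat.factorial_succ, Nat.cast_mul, Nat.cast_add_one]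
        field_simp) n
    have hn : (n : K) + 1 ≠ 0 := Nat.cast_add_one_ne_zero n
    have hf : (n.factorial : K) ≠ 0 := Nat.cast_ne_zero.mpr n.factorial_ne_zero
    refine mul_left_cancel₀ (pow_ne_zero 3 hn) (step.trans ?_)
    rw [ih]
    simp only [ascPochhammer_succ_eval, Nat.factorial_succ, Nat.cast_mul, Nat.cast_add_one]
    field_simp


/-- Coefficient-wise form of Clausen's identity
₃F₂(1/4,2/4,3/4;1,1;w) = (₂F₁(1/8,3/8;1;w))², from the end of Section 4. -/
theorem clausen_coefficients (n : ℕ) :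
    ∑ k ∈ Finset.range (n + 1),
        ((ascPochhammer ℚ k).eval (1 / 8) * (ascPochhammer ℚ k).eval (3 / 8) /
            (k.factorial : ℚ) ^ 2) *
          ((ascPochhammer ℚ (n - k)).eval (1 / 8) *
              (ascPochhammer ℚ (n - k)).eval (3 / 8) /
            ((n - k).factorial : ℚ) ^ 2) =
      (ascPochhammer ℚ n).eval (1 / 4) * (ascPochhammer ℚ n).eval (1 / 2) *
          (ascPochhammer ℚ n).eval (3 / 4) / (n.factorial : ℚ) ^ 3 := by
  have h := sum_antidiagonal_clausen (K := ℚ) (a := 1 / 8) (b := 3 / 8) (by norm_num) n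
  rw [Finset.Nat.sum_antidiagonal_eq_sum_range_succ_mk] at h
  norm_num at h ⊢
  exact h
end
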